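/- Let n ≥ 5 and let α be a noncrossing set of diagonals of the convex n-gon with cardinality k, where 1 ≤ k ≤ n − 4. Then there exist a natural number N, a simplicial complex L in ℝ^N (in the sense of Mathlib's Geometry.SimplicialComplex), and a bijection e from the set of diagonals d with d ∉ α such that d crosses no element of α, to the set of vertices of L, such that a nonempty finite set S of such diagonals is noncrossing if and only if the image of S under e is the vertex set of a simplex of L, and such that the underlying space of L is homeomorphic to the Euclidean sphere of dimension n − 4 − k. -/

import Mathlib

/-- A diagonal of the convex `n`-gon with vertices `0, 1, …, n-1` in cyclic order:
a pair `(a, b)` with `a < b`, `b < n`, `b - a ≥ 2`, and `(a, b) ≠ (0, n-1)`. -/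
def Diag (n : ℕ) : Set (ℕ × ℕ) :=
  {p | p.1 < p.2 ∧ p.2 < n ∧ 2 ≤ p.2 - p.1 ∧ p ≠ (0, n - 1)}

/-- Two diagonals `(a,b)` and `(c,d)` cross if `a < c < b < d` or `c < a < d < b`. -/
def Crosses (p q : ℕ × ℕ) : Prop :=
  (p.1 < q.1 ∧ q.1 < p.2 ∧ p.2 < q.2) ∨ (q.1 < p.1 ∧ p.1 < q.2 ∧ q.2 < p.2)

/-- A set of diagonals is noncrossing if no two of its elements cross. -/
def Noncrossing (S : Set (ℕ × ℕ)) : Prop :=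
  ∀ p ∈ S, ∀ q ∈ S, ¬ Crosses p q

/-- The diagonals of the `n`-gon not in `α` and crossing no element of `α`:
the vertices of the link of the simplex corresponding to `α`. -/
def LinkDiag (n : ℕ) (α : Finset (ℕ × ℕ)) : Type :=
  {d : ℕ × ℕ // d ∈ Diag n ∧ d ∉ α ∧ ∀ a ∈ α, ¬ Crosses d a}

/-- The total weight of the diagonals of `T` separating the vertex `i` from the side
`(0, n - 1)`. -/
def cover (T : Finset (ℕ × ℕ)) (c : ℕ × ℕ → ℝ) (i : ℕ) : ℝ :=
  ∑ p ∈ T with p.1 < i ∧ i < p.2, c p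

lemma cover_sub (T : Finset (ℕ × ℕ)) (c c' : ℕ × ℕ → ℝ) (i : ℕ) :
    cover T (c - c') i = cover T c i - cover T c' i := by
  simp [cover]

lemma cover_pos {T : Finset (ℕ × ℕ)} {c : ℕ × ℕ → ℝ} (hc : ∀ p ∈ T, 0 ≤ c p) {p : ℕ × ℕ}
    (hp : p ∈ T) (hcp : c p ≠ 0) {i : ℕ} (h₁ : p.1 < i) (h₂ : i < p.2) : 0 < cover T c i :=
  Finset.sum_pos' (fun q hq => hc q (Finset.mem_of_mem_filter q hq))
    ⟨p, by simp [*], (hc p hp).lt_of_ne' hcp⟩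

lemma exists_of_cover_ne_zero {T : Finset (ℕ × ℕ)} {c : ℕ × ℕ → ℝ} {i : ℕ}
    (h : cover T c i ≠ 0) : ∃ p ∈ T, c p ≠ 0 ∧ p.1 < i ∧ i < p.2 := by
  obtain ⟨p, hp, hc⟩ := Finset.exists_ne_zero_of_sum_ne_zero h
  rw [Finset.mem_filter] at hp
  exact ⟨p, hp.1, hc, hp.2⟩

lemma Noncrossing.mono {S S' : Set (ℕ × ℕ)} (h : Noncrossing S) (hS : S' ⊆ S) : Noncrossing S' :=
  fun p hp q hq => h p (hS hp) q (hS hq)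

/-- Two noncrossing weightings with disjoint supports and the same coverage vanish on the longest
diagonals occurring in either. -/
lemma eq_zero_of_longest {T : Finset (ℕ × ℕ)} (hT : ∀ p ∈ T, p.1 + 2 ≤ p.2)
    {c c' : ℕ × ℕ → ℝ} (hc : ∀ p ∈ T, 0 ≤ c p) (hc' : ∀ p ∈ T, 0 ≤ c' p)
    (hn : Noncrossing {p | p ∈ T ∧ c p ≠ 0}) (hn' : Noncrossing {p | p ∈ T ∧ c' p ≠ 0})
    (hdisj : ∀ p ∈ T, c p = 0 ∨ c' p = 0) (h : ∀ i, cover T c i = cover T c' i)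
    {p : ℕ × ℕ} (hp : p ∈ T) (hmax : ∀ q ∈ T, c q ≠ 0 ∨ c' q ≠ 0 → q.2 - q.1 ≤ p.2 - p.1) :
    c p = 0 := by
  by_contra hcp
  have hpT := hT p hp
  have hc'p := (hdisj p hp).resolve_left hcp
  have hend : ∀ i, i = p.1 ∨ i = p.2 → cover T c' i = 0 := by
    intro i hi
    rw [← h]
    by_contra hne
    obtain ⟨q, hq, hcq, h₁, h₂⟩ := exists_of_cover_ne_zero hne
    have := hn p ⟨hp, hcp⟩ q ⟨hq, hcq⟩
    have := hmax q hq (Or.inl hcq)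
    unfold Crosses at *
    omega
  have havoid : ∀ q ∈ T, c' q ≠ 0 → ∀ i, i = p.1 ∨ i = p.2 → ¬ (q.1 < i ∧ i < q.2) :=
    fun q hq hcq i hi hlt => (cover_pos hc' hq hcq hlt.1 hlt.2).ne' (hend i hi)
  have hcov : ∀ i, p.1 < i → i < p.2 → ∃ q ∈ T, c' q ≠ 0 ∧ q.1 < i ∧ i < q.2 :=
    fun i h₁ h₂ => exists_of_cover_ne_zero (h i ▸ (cover_pos hc hp hcp h₁ h₂).ne')
  have hinside : ∀ q ∈ T, c' q ≠ 0 → ∀ i, p.1 < i → i < p.2 → q.1 < i → i < q.2 →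
      p.1 ≤ q.1 ∧ q.2 ≤ p.2 := by
    intro q hq hcq i h₁ h₂ h₃ h₄
    have := havoid q hq hcq p.1 (Or.inl rfl)
    have := havoid q hq hcq p.2 (Or.inr rfl)
    omega
  obtain ⟨q₀, hq₀, hcq₀, h₀, h₀'⟩ := hcov (p.1 + 1) (by omega) (by omega)
  have hne : (T.filter fun q => c' q ≠ 0 ∧ p.1 ≤ q.1 ∧ q.2 ≤ p.2).Nonempty :=
    ⟨q₀, Finset.mem_filter.2
      ⟨hq₀, hcq₀, hinside q₀ hq₀ hcq₀ (p.1 + 1) (by omega) (by omega) h₀ h₀'⟩⟩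
  obtain ⟨q, hq, hqmax⟩ := Finset.exists_max_image _ (fun q => q.2 - q.1) hne
  simp only [Finset.mem_filter] at hq hqmax
  obtain ⟨hq, hcq, hpq₁, hpq₂⟩ := hq
  have hqT := hT q hq
  have hqp : q.1 ≠ p.1 ∨ q.2 ≠ p.2 := by
    by_contra! hcon
    exact hcq (Prod.ext hcon.1 hcon.2 ▸ hc'p)
  have key : ∀ i, i = q.1 ∨ i = q.2 → p.1 < i → i < p.2 → False := by
    intro i hi h₁ h₂
    obtain ⟨r, hr, hcr, h₃, h₄⟩ := hcov i h₁ h₂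
    have := hqmax r ⟨hr, hcr, hinside r hr hcr i h₁ h₂ h₃ h₄⟩
    have := hn' q ⟨hq, hcq⟩ r ⟨hr, hcr⟩
    unfold Crosses at this
    omega
  rcases hqp with hqp | hqp
  · exact key q.1 (Or.inl rfl) (by omega) (by omega)
  · exact key q.2 (Or.inr rfl) (by omega) (by omega)

/-- A weighting with noncrossing support is determined by its coverage. -/
theorem eq_of_cover_eq {T : Finset (ℕ × ℕ)} (hT : ∀ p ∈ T, p.1 + 2 ≤ p.2)
    {c c' : ℕ × ℕ → ℝ} (hc : ∀ p ∈ T, 0 ≤ c p) (hc' : ∀ p ∈ T, 0 ≤ c' p)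
    (hn : Noncrossing {p | p ∈ T ∧ c p ≠ 0}) (hn' : Noncrossing {p | p ∈ T ∧ c' p ≠ 0})
    (h : ∀ i, cover T c i = cover T c' i) : ∀ p ∈ T, c p = c' p := by
  set b := c - c ⊓ c' with hb
  set b' := c' - c ⊓ c' with hb'
  have hbb : ∀ p, b p = c p - min (c p) (c' p) ∧ b' p = c' p - min (c p) (c' p) :=
    fun p => ⟨rfl, rfl⟩
  have hb0 : ∀ p ∈ T, 0 ≤ b p := fun p _ => sub_nonneg.2 (min_le_left _ _)
  have hb0' : ∀ p ∈ T, 0 ≤ b' p := fun p _ => sub_nonneg.2 (min_le_right _ _)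
  have hbn : Noncrossing {p | p ∈ T ∧ b p ≠ 0} := hn.mono fun p hp => by
    refine ⟨hp.1, fun h0 => hp.2 ?_⟩
    rw [(hbb p).1, h0, min_eq_left (hc' p hp.1), sub_zero]
  have hbn' : Noncrossing {p | p ∈ T ∧ b' p ≠ 0} := hn'.mono fun p hp => by
    refine ⟨hp.1, fun h0 => hp.2 ?_⟩
    rw [(hbb p).2, h0, min_eq_right (hc p hp.1), sub_zero]
  have hdisj : ∀ p ∈ T, b p = 0 ∨ b' p = 0 := fun p _ => by
    rcases le_total (c p) (c' p) with h | h <;> simp [hbb, h]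
  have hcov : ∀ i, cover T b i = cover T b' i := fun i => by
    rw [hb, hb', cover_sub, cover_sub, h]
  by_contra! hcon
  obtain ⟨p₀, hp₀, hne⟩ := hcon
  have hne : (T.filter fun q => b q ≠ 0 ∨ b' q ≠ 0).Nonempty :=
    ⟨p₀, Finset.mem_filter.2 ⟨hp₀, by
      by_contra! h0
      exact hne (by linarith [hbb p₀])⟩⟩
  obtain ⟨p, hp, hmax⟩ := Finset.exists_max_image _ (fun q => q.2 - q.1) hne
  simp only [Finset.mem_filter] at hp hmax
  have h₁ := eq_zero_of_longest hT hb0 hb0' hbn hbn' hdisj hcov hp.1 fun q hq h => hmax q ⟨hq, h⟩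
  have h₂ := eq_zero_of_longest hT hb0' hb0 hbn' hbn (fun p hp => (hdisj p hp).symm)
    (fun i => (hcov i).symm) hp.1 fun q hq h => hmax q ⟨hq, h.symm⟩
  exact hp.2.elim (· h₁) (· h₂)

/-- The diagonals of the `n`-gon together with the side `(0, n - 1)`. -/
def chords (n : ℕ) : Finset (ℕ × ℕ) :=
  (Finset.range n ×ˢ Finset.range n).filter fun p => p.1 + 2 ≤ p.2

lemma mem_chords {n : ℕ} {p : ℕ × ℕ} : p ∈ chords n ↔ p.1 + 2 ≤ p.2 ∧ p.2 < n := by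
  simp only [chords, Finset.mem_filter, Finset.mem_product, Finset.mem_range]
  omega

/-- Every nonnegative function on the vertices `1, …, n - 2` is the coverage of a nonnegative
weighting with noncrossing support; a chord whose endpoints have smaller values than all the
vertices it separates off has nonzero weight. -/
theorem exists_cover_eq (n : ℕ) (m : ℕ → ℝ) (hm : ∀ i, 0 ≤ m i)
    (hm0 : ∀ i, m i ≠ 0 → 0 < i ∧ i + 1 < n) :
    ∃ c : ℕ × ℕ → ℝ, (∀ p, 0 ≤ c p) ∧ Noncrossing {p | p ∈ chords n ∧ c p ≠ 0} ∧
      (∀ i, cover (chords n) c i = m i) ∧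
      ∀ p ∈ chords n, (∀ i, p.1 < i → i < p.2 → m p.1 < m i ∧ m p.2 < m i) → c p ≠ 0 := by
  induction hN : ((Finset.range n).filter fun i => m i ≠ 0).card using Nat.strong_induction_on
    generalizing m with
  | _ N ih =>
  by_cases hzero : ∀ i, m i = 0
  · refine ⟨0, fun p => le_rfl, fun p hp => (hp.2 rfl).elim, fun i => by simp [cover, hzero], ?_⟩
    intro p hp hlt
    have := mem_chords.1 hp
    have := (hlt (p.1 + 1) (by omega) (by omega)).1
    simp [hzero] at this
  push Not at hzero
  obtain ⟨i₀, hi₀⟩ := hzero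
  have hi₀n := hm0 i₀ hi₀
  have hmzero : ∀ i, ¬ (0 < i ∧ i + 1 < n) → m i = 0 := fun i hi => by
    by_contra h
    exact hi (hm0 i h)
  -- the component `(a, b)` of the support around `i₀`
  obtain ⟨a, ha0, hai, ha⟩ : ∃ a, m a = 0 ∧ a < i₀ ∧ ∀ i, a < i → i ≤ i₀ → m i ≠ 0 := by
    obtain ⟨a, ha, hmax⟩ := Finset.exists_max_image ((Finset.range i₀).filter fun i => m i = 0) id
      ⟨0, by simp [hi₀n.1, hmzero]⟩
    simp only [Finset.mem_filter, Finset.mem_range, id] at ha hmax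
    refine ⟨a, ha.2, ha.1, fun i h₁ h₂ h => ?_⟩
    rcases h₂.eq_or_lt with rfl | h₂
    · exact hi₀ h
    · exact absurd (hmax i ⟨h₂, h⟩) (by omega)
  obtain ⟨b, hb0, hib, hbn, hb⟩ :
      ∃ b, m b = 0 ∧ i₀ < b ∧ b < n ∧ ∀ i, i₀ ≤ i → i < b → m i ≠ 0 := by
    obtain ⟨b, hb, hmin⟩ := Finset.exists_min_image
      ((Finset.range n).filter fun i => i₀ < i ∧ m i = 0) id
      ⟨n - 1, Finset.mem_filter.2
        ⟨Finset.mem_range.2 (by omega), by omega, hmzero _ (by omega)⟩⟩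
    simp only [Finset.mem_filter, Finset.mem_range, id] at hb hmin
    refine ⟨b, hb.2.2, hb.2.1, hb.1, fun i h₁ h₂ h => ?_⟩
    rcases h₁.eq_or_lt with rfl | h₁
    · exact hi₀ h
    · exact absurd (hmin i ⟨by omega, h₁, h⟩) (by omega)
  have hpos : ∀ i, a < i → i < b → 0 < m i := fun i h₁ h₂ =>
    (hm i).lt_of_ne' ((le_total i i₀).elim (ha i h₁) fun h => hb i h h₂)
  obtain ⟨j, hj, hjmin⟩ := Finset.exists_min_image (Finset.Ioo a b) m
    ⟨i₀, Finset.mem_Ioo.2 ⟨hai, hib⟩⟩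
  simp only [Finset.mem_Ioo] at hj hjmin
  have hjpos := hpos j hj.1 hj.2
  have hI : (a, b) ∈ chords n := mem_chords.2 ⟨by simp; omega, hbn⟩
  set m' : ℕ → ℝ := fun i => if a < i ∧ i < b then m i - m j else m i with hm'
  have hm'le : ∀ i, m' i ≤ m i := fun i => by simp only [hm']; split_ifs <;> linarith
  have hm'0 : ∀ i, 0 ≤ m' i := fun i => by
    simp only [hm']; split_ifs with h
    · linarith [hjmin i h]
    · exact hm i
  have hm'supp : ∀ i, m' i ≠ 0 → m i ≠ 0 := fun i hi h0 =>
    hi (le_antisymm (h0 ▸ hm'le i) (hm'0 i))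
  obtain ⟨c, hc, hn, hcov, hlocal⟩ := ih _ (by
    rw [← hN]
    refine Finset.card_lt_card (Finset.ssubset_iff_subset_ne.2 ⟨fun i hi => ?_, fun heq => ?_⟩)
    · simp only [Finset.mem_filter] at hi ⊢
      exact ⟨hi.1, hm'supp i hi.2⟩
    · have : j ∈ (Finset.range n).filter fun i => m' i ≠ 0 := by
        rw [heq]
        simp only [Finset.mem_filter, Finset.mem_range]
        exact ⟨by omega, hjpos.ne'⟩
      simp [hm', hj] at this) m' hm'0 (fun i hi => hm0 i (hm'supp i hi)) rfl
  have havoid : ∀ p ∈ chords n, c p ≠ 0 → ∀ i, m i = 0 → ¬ (p.1 < i ∧ i < p.2) :=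
    fun p hp hcp i hi hlt => hm'supp i
      (hcov i ▸ (cover_pos (fun q _ => hc q) hp hcp hlt.1 hlt.2).ne') hi
  set δ : ℕ × ℕ → ℝ := fun p => if p = (a, b) then m j else 0 with hδ
  refine ⟨c + δ, fun p => add_nonneg (hc p) ?_, ?_, fun i => ?_, ?_⟩
  · simp only [hδ]; split_ifs <;> linarith
  · have hsupp : ∀ p, p ∈ chords n ∧ (c + δ) p ≠ 0 →
        p = (a, b) ∨ p ∈ chords n ∧ c p ≠ 0 := fun p hp => by
      by_cases hpI : p = (a, b)
      · exact Or.inl hpI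
      · exact Or.inr ⟨hp.1, by simpa [hδ, hpI] using hp.2⟩
    intro p hp q hq
    rcases hsupp p hp with rfl | hp <;> rcases hsupp q hq with rfl | hq
    · simp [Crosses]
    · have h₁ := havoid q hq.1 hq.2 a ha0
      have h₂ := havoid q hq.1 hq.2 b hb0
      simp only [Crosses]; omega
    · have h₁ := havoid p hp.1 hp.2 a ha0
      have h₂ := havoid p hp.1 hp.2 b hb0
      simp only [Crosses]; omega
    · exact hn p hp q hq
  · have : cover (chords n) (c + δ) i
        = cover (chords n) c i + if a < i ∧ i < b then m j else 0 := by
      simp only [cover, Pi.add_apply, Finset.sum_add_distrib, hδ, Finset.sum_ite_eq',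
        Finset.mem_filter, hI, true_and]
    rw [this, hcov]
    simp only [hm']
    split_ifs <;> simp
  · intro p hp hlt
    by_cases hpI : p = (a, b)
    · subst hpI
      simp only [Pi.add_apply, hδ, if_true]
      linarith [hc (a, b)]
    simp only [Pi.add_apply, hδ, if_neg hpI, add_zero]
    refine hlocal p hp fun i h₁ h₂ => ?_
    have hpI' : p.1 ≠ a ∨ p.2 ≠ b := by
      by_contra! h
      exact hpI (Prod.ext h.1 h.2)
    have hne : ∀ i, m i = 0 → ¬ (p.1 < i ∧ i < p.2) := fun i hi h => by
      have := (hlt i h.1 h.2).1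
      linarith [hm p.1]
    have hnea := hne a ha0
    have hneb := hne b hb0
    obtain ⟨hl₁, hl₂⟩ := hlt i h₁ h₂
    by_cases hiI : a < i ∧ i < b
    · have hp₁ : p.1 = a ∨ a < p.1 ∧ p.1 < b := by omega
      have hp₂ : p.2 = b ∨ a < p.2 ∧ p.2 < b := by omega
      simp only [hm', hiI]
      rcases hp₁ with hp₁ | hp₁ <;> rcases hp₂ with hp₂ | hp₂
      · omega
      · have := hjmin p.2 hp₂
        simp [hp₁, hp₂, ha0]
        constructor <;> linarith
      · have := hjmin p.1 hp₁
        simp [hp₁, hp₂, hb0]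
        constructor <;> linarith
      · simp [hp₁, hp₂, hl₁, hl₂]
    · have : m' i = m i := if_neg hiI
      rw [this]
      exact ⟨(hm'le _).trans_lt hl₁, (hm'le _).trans_lt hl₂⟩

section Fan

variable {N : ℕ} {E : Type*} [NormedAddCommGroup E] [NormedSpace ℝ E]

/-- The standard geometric realization in `ℝ ^ N` of an abstract simplicial complex whose
simplices are the nonempty finite sets satisfying a hereditary property `P`. -/
noncomputable def stdRealization (P : Set (Fin N) → Prop)
    (hP : ∀ S S', P S → S' ⊆ S → P S') : Geometry.SimplicialComplex ℝ (Fin N → ℝ) :=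
  open Classical in
  Geometry.SimplicialComplex.ofAffineIndependent
    { faces := {s | ∃ S : Finset (Fin N), S.Nonempty ∧ P S ∧
        s = S.image fun i => (Pi.single i 1 : Fin N → ℝ)}
      isRelLowerSet_faces := by
        rintro s ⟨S, hS, hPS, rfl⟩
        refine ⟨hS.image _, fun t ht hne => ?_⟩
        obtain ⟨S', hS', rfl⟩ := Finset.subset_image_iff.1 ht
        exact ⟨S', Finset.image_nonempty.1 hne, hP _ _ hPS hS', rfl⟩ }
    ((Pi.linearIndependent_single_one (Fin N) ℝ).affineIndependent.range.mono fun x hx => by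
      simp only [Set.mem_iUnion, Finset.mem_coe] at hx
      obtain ⟨_, ⟨S, _, _, rfl⟩, hx⟩ := hx
      obtain ⟨i, _, rfl⟩ := Finset.mem_image.1 hx
      exact ⟨i, rfl⟩)

variable {P : Set (Fin N) → Prop} {hP : ∀ S S', P S → S' ⊆ S → P S'}

lemma mem_stdRealization_faces {s : Finset (Fin N → ℝ)} :
    s ∈ (stdRealization P hP).faces ↔ ∃ S : Finset (Fin N), S.Nonempty ∧ P S ∧
      (s : Set (Fin N → ℝ)) = (fun i => Pi.single i 1) '' (S : Set (Fin N)) := by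
  classical
  simp only [← Finset.coe_image, Finset.coe_inj]
  exact Iff.of_eq (by unfold stdRealization; congr!)

lemma mem_stdRealization_space {x : Fin N → ℝ} :
    x ∈ (stdRealization P hP).space ↔ 0 ≤ x ∧ ∑ i, x i = 1 ∧ P (Function.support x) := by
  rw [Geometry.SimplicialComplex.mem_space_iff]
  constructor
  · rintro ⟨s, hs, hx⟩
    obtain ⟨S, hS, hPS, hs⟩ := mem_stdRealization_faces.1 hs
    have hconv : Convex ℝ (stdSimplex ℝ (Fin N) ∩ {y | ∀ i ∉ S, y i = 0}) := by
      refine (convex_stdSimplex ℝ (Fin N)).inter fun y hy z hz a b _ _ _ i hi => ?_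
      simp [hy i hi, hz i hi]
    have hsub : (s : Set (Fin N → ℝ)) ⊆ stdSimplex ℝ (Fin N) ∩ {y | ∀ i ∉ S, y i = 0} := by
      rw [hs]
      rintro _ ⟨i, hi, rfl⟩
      exact ⟨single_mem_stdSimplex ℝ i, fun j hj =>
        Pi.single_eq_of_ne (by rintro rfl; exact hj hi) _⟩
    have := convexHull_min hsub hconv hx
    refine ⟨this.1.1, this.1.2, hP _ _ hPS fun i hi => ?_⟩
    by_contra hiS
    exact hi (this.2 i hiS)
  · classical
    rintro ⟨h0, h1, hPx⟩
    set S : Finset (Fin N) := Finset.univ.filter fun i => x i ≠ 0 with hS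
    have hSx : (S : Set (Fin N)) = Function.support x := by ext; simp [hS]
    have hsum : ∑ i ∈ S, x i = 1 := by rw [hS, Finset.sum_filter_ne_zero, h1]
    have hne : S.Nonempty := Finset.nonempty_iff_ne_empty.2 fun h => by simp [h] at hsum
    refine ⟨S.image fun i => Pi.single i 1,
      mem_stdRealization_faces.2 ⟨S, hne, hSx ▸ hPx, Finset.coe_image⟩, ?_⟩
    have hx : x = ∑ i ∈ S, x i • (Pi.single i 1 : Fin N → ℝ) := by
      ext j
      simp [Finset.sum_apply, Pi.single_apply, hS]
    have := (convex_convexHull ℝ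
      ((S.image fun i => Pi.single i 1 : Finset (Fin N → ℝ)) : Set (Fin N → ℝ))).sum_mem
        (fun i _ => h0 i) hsum
        (fun i hi => subset_convexHull ℝ _ (Finset.mem_coe.2 (Finset.mem_image_of_mem _ hi)))
    rwa [← hx] at this

lemma isCompact_stdRealization_space : IsCompact (stdRealization P hP).space := by
  classical
  refine Set.Finite.isCompact_biUnion ?_ fun s _ => s.finite_toSet.isCompact_convexHull ℝ
  refine (Set.finite_range fun S : Finset (Fin N) =>
    S.image fun i => (Pi.single i 1 : Fin N → ℝ)).subset fun s hs => ?_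
  obtain ⟨S, _, _, hs⟩ := mem_stdRealization_faces.1 hs
  exact ⟨S, Finset.coe_injective (by rw [hs, Finset.coe_image])⟩

/-- If a linear map sends the cones over the simplices of a simplicial complex to the cones of a
complete simplicial fan, then the realization of the complex is a sphere. -/
theorem nonempty_stdRealization_space_homeomorph_sphere (φ : (Fin N → ℝ) →ₗ[ℝ] E)
    (hex : ∀ x, ∃ c, 0 ≤ c ∧ P (Function.support c) ∧ φ c = x)
    (huniq : ∀ c c', 0 ≤ c → 0 ≤ c' → P (Function.support c) → P (Function.support c') →
      φ c = φ c' → c = c') :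
    Nonempty ((stdRealization P hP).space ≃ₜ Metric.sphere (0 : E) 1) := by
  have hPsmul : ∀ (r : ℝ) (c : Fin N → ℝ), P (Function.support c) → P (Function.support (r • c)) :=
    fun r c hc => hP _ _ hc fun i hi h0 => hi (by simp [h0])
  have hne : ∀ x : (stdRealization P hP).space, φ x ≠ 0 := by
    rintro ⟨x, hx⟩ h
    obtain ⟨h0, h1, hPx⟩ := mem_stdRealization_space.1 hx
    have : x = 0 := huniq x 0 h0 le_rfl hPx (hP _ _ hPx (by simp)) (by simpa using h)
    simp [this] at h1
  let f : (stdRealization P hP).space → Metric.sphere (0 : E) 1 := fun x =>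
    ⟨‖φ x‖⁻¹ • φ x, by simp [norm_smul, hne x]⟩
  have hf : Continuous f := by
    have hφ : Continuous fun x : (stdRealization P hP).space => φ x :=
      φ.continuous_of_finiteDimensional.comp continuous_subtype_val
    exact ((hφ.norm.inv₀ fun x => norm_ne_zero_iff.2 (hne x)).smul hφ).subtype_mk _
  have hinj : Function.Injective f := by
    rintro x y hxy
    obtain ⟨hx0, hx1, hPx⟩ := mem_stdRealization_space.1 x.2
    obtain ⟨hy0, hy1, hPy⟩ := mem_stdRealization_space.1 y.2
    have hxy' : ‖φ x‖⁻¹ • φ x = ‖φ y‖⁻¹ • φ y := congrArg Subtype.val hxy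
    rw [← map_smul, ← map_smul] at hxy'
    have h := huniq _ _ (smul_nonneg (inv_nonneg.2 (norm_nonneg _)) hx0)
      (smul_nonneg (inv_nonneg.2 (norm_nonneg _)) hy0) (hPsmul _ _ hPx) (hPsmul _ _ hPy) hxy'
    have hsum := congrArg (fun c : Fin N → ℝ => ∑ i, c i) h
    simp only [Pi.smul_apply, smul_eq_mul, ← Finset.mul_sum, hx1, hy1, mul_one] at hsum
    rw [hsum] at h
    exact Subtype.ext (smul_right_injective _ (inv_ne_zero (norm_ne_zero_iff.2 (hne y))) h)
  have hsurj : Function.Surjective f := by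
    rintro ⟨z, hz⟩
    have hz1 : ‖z‖ = 1 := by simpa using hz
    obtain ⟨c, hc0, hPc, rfl⟩ := hex z
    have hpos : 0 < ∑ i, c i := by
      refine (Finset.sum_nonneg fun i _ => hc0 i).lt_of_ne' fun h => ?_
      have : c = 0 := funext fun i =>
        (Finset.sum_eq_zero_iff_of_nonneg fun i _ => hc0 i).1 h i (Finset.mem_univ i)
      simp [this] at hz1
    refine ⟨⟨(∑ i, c i)⁻¹ • c, mem_stdRealization_space.2
      ⟨smul_nonneg (inv_nonneg.2 hpos.le) hc0, ?_, hPsmul _ _ hPc⟩⟩, Subtype.ext ?_⟩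
    · simp only [Pi.smul_apply, smul_eq_mul, ← Finset.mul_sum]
      exact inv_mul_cancel₀ hpos.ne'
    · simp only [f, map_smul, norm_smul, hz1, norm_inv, Real.norm_of_nonneg hpos.le, mul_one,
        inv_inv, smul_smul, mul_inv_cancel₀ hpos.ne', one_smul]
  have := isCompact_iff_compactSpace.1 (isCompact_stdRealization_space (P := P) (hP := hP))
  exact ⟨Continuous.homeoOfEquivCompactToT2 (f := Equiv.ofBijective f ⟨hinj, hsurj⟩) hf⟩

end Fan

lemma Crosses.symm {p q : ℕ × ℕ} (h : Crosses p q) : Crosses q p := Or.symm h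

/-- The indicator function of the vertices among `1, …, n - 2` separated by `p` from the side
`(0, n - 1)`. -/
def chordVec (n : ℕ) (p : ℕ × ℕ) : Fin (n - 2) → ℝ :=
  fun i => if p.1 < (i : ℕ) + 1 ∧ (i : ℕ) + 1 < p.2 then 1 else 0

lemma sum_smul_chordVec_apply (n : ℕ) (T : Finset (ℕ × ℕ)) (c : ℕ × ℕ → ℝ) (i : Fin (n - 2)) :
    (∑ p ∈ T, c p • chordVec n p) i = cover T c (i + 1) := by
  simp [cover, chordVec, Finset.sum_filter]

lemma cover_chords_eq_zero {n : ℕ} (c : ℕ × ℕ → ℝ) {i : ℕ} (hi : ¬ (0 < i ∧ i + 1 < n)) :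
    cover (chords n) c i = 0 := by
  by_contra h
  obtain ⟨p, hp, _, h₁, h₂⟩ := exists_of_cover_ne_zero h
  have := mem_chords.1 hp
  omega

/-- The weighting `c` is nonnegative off `β`, and its support together with `β` is noncrossing. -/
def IsLinkWeight (n : ℕ) (β : Finset (ℕ × ℕ)) (c : ℕ × ℕ → ℝ) : Prop :=
  (∀ p ∈ chords n, p ∉ β → 0 ≤ c p) ∧ Noncrossing {p | p ∈ chords n ∧ (c p ≠ 0 ∨ p ∈ β)}

section LinkWeight

variable {n : ℕ} {β : Finset (ℕ × ℕ)}

theorem IsLinkWeight.eq_of_sum_eq {c c' : ℕ × ℕ → ℝ} (hc : IsLinkWeight n β c)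
    (hc' : IsLinkWeight n β c')
    (h : ∑ p ∈ chords n, c p • chordVec n p = ∑ p ∈ chords n, c' p • chordVec n p) :
    ∀ p ∈ chords n, c p = c' p := by
  set t : ℝ := ∑ p ∈ β, (|c p| + |c' p|) with ht
  have htle : ∀ p ∈ β, |c p| + |c' p| ≤ t := fun p hp =>
    Finset.single_le_sum (f := fun p => |c p| + |c' p|) (fun q _ => by positivity) hp
  set s : ℕ × ℕ → ℝ := fun p => if p ∈ β then t else 0 with hs
  have hnonneg : ∀ {b : ℕ × ℕ → ℝ}, IsLinkWeight n β b → (∀ p ∈ β, |b p| ≤ t) →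
      ∀ p ∈ chords n, 0 ≤ (b + s) p := by
    intro b hb hbt p hp
    by_cases hpβ : p ∈ β
    · simp only [Pi.add_apply, hs, hpβ, if_true]
      linarith [neg_abs_le (b p), hbt p hpβ]
    · simpa [hs, hpβ] using hb.1 p hp hpβ
  have hnoncross : ∀ {b : ℕ × ℕ → ℝ}, IsLinkWeight n β b →
      Noncrossing {p | p ∈ chords n ∧ (b + s) p ≠ 0} := by
    intro b hb
    refine hb.2.mono fun p hp => ⟨hp.1, ?_⟩
    by_cases hpβ : p ∈ β
    · exact Or.inr hpβ
    · exact Or.inl (by simpa [hs, hpβ] using hp.2)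
  have hcov : ∀ i, cover (chords n) (c + s) i = cover (chords n) (c' + s) i := by
    intro i
    by_cases hi : 0 < i ∧ i + 1 < n
    · have := congrFun h ⟨i - 1, by omega⟩
      rw [sum_smul_chordVec_apply, sum_smul_chordVec_apply] at this
      simp only [Nat.sub_add_cancel hi.1] at this
      simpa [cover, Finset.sum_add_distrib] using this
    · rw [cover_chords_eq_zero _ hi, cover_chords_eq_zero _ hi]
  intro p hp
  have := eq_of_cover_eq (fun p hp => (mem_chords.1 hp).1)
    (hnonneg hc fun p hp => by linarith [htle p hp, abs_nonneg (c' p)])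
    (hnonneg hc' fun p hp => by linarith [htle p hp, abs_nonneg (c p)])
    (hnoncross hc) (hnoncross hc') hcov p hp
  simpa using this

theorem exists_isLinkWeight (hn : 2 ≤ n) (hβ : β ⊆ chords n) (hnc : Noncrossing (β : Set (ℕ × ℕ)))
    (hside : (0, n - 1) ∈ β) (x : Fin (n - 2) → ℝ) :
    ∃ c, IsLinkWeight n β c ∧ ∑ p ∈ chords n, c p • chordVec n p = x := by
  classical
  set C : ℝ := ∑ i, |x i| with hC
  have hC0 : 0 ≤ C := Finset.sum_nonneg fun i _ => abs_nonneg _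
  have hxC : ∀ i, -C ≤ x i ∧ x i ≤ C := fun i => abs_le.1
    (Finset.single_le_sum (f := fun i => |x i|) (fun i _ => abs_nonneg _) (Finset.mem_univ i))
  set t : ℝ := 2 * C + 1 with ht
  set k : ℕ → ℕ := fun i => (β.filter fun p => p.1 < i ∧ i < p.2).card with hk
  set m : ℕ → ℝ := fun i => if h : 0 < i ∧ i + 1 < n then x ⟨i - 1, by omega⟩ + t * k i else 0
    with hm
  have hmin : ∀ i (h : 0 < i ∧ i + 1 < n), m i = x ⟨i - 1, by omega⟩ + t * k i :=
    fun i h => dif_pos h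
  have hmout : ∀ i, ¬ (0 < i ∧ i + 1 < n) → m i = 0 := fun i h => dif_neg h
  have hkpos : ∀ i, 0 < i ∧ i + 1 < n → (1 : ℝ) ≤ k i := fun i hi => by
    exact_mod_cast Finset.card_pos.2 ⟨(0, n - 1), Finset.mem_filter.2 ⟨hside, by simp; omega⟩⟩
  have hmpos : ∀ i, 0 < i ∧ i + 1 < n → 0 < m i := fun i hi => by
    rw [hmin i hi]
    nlinarith [hkpos i hi, (hxC ⟨i - 1, by omega⟩).1]
  have hkstep : ∀ p ∈ β, ∀ i j, p.1 < i → i < p.2 → j = p.1 ∨ j = p.2 → k j + 1 ≤ k i := by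
    intro p hp i j h₁ h₂ hj
    refine Finset.card_lt_card (Finset.ssubset_iff_subset_ne.2 ⟨fun q hq => ?_, fun heq => ?_⟩)
    · simp only [Finset.mem_filter] at hq ⊢
      have := hnc p hp q hq.1
      have := (mem_chords.1 (hβ hp)).1
      unfold Crosses at *
      exact ⟨hq.1, by omega⟩
    · have : p ∈ β.filter fun q => q.1 < j ∧ j < q.2 := heq ▸ by simp [hp, h₁, h₂]
      simp only [Finset.mem_filter] at this
      omega
  have hmstep : ∀ p ∈ β, ∀ i j, p.1 < i → i < p.2 → j = p.1 ∨ j = p.2 → m j < m i := by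
    intro p hp i j h₁ h₂ hj
    have := mem_chords.1 (hβ hp)
    have hi : 0 < i ∧ i + 1 < n := by omega
    by_cases hj' : 0 < j ∧ j + 1 < n
    · have hstep : (k j : ℝ) + 1 ≤ k i := by exact_mod_cast hkstep p hp i j h₁ h₂ hj
      rw [hmin i hi, hmin j hj']
      nlinarith [(hxC ⟨i - 1, by omega⟩).1, (hxC ⟨j - 1, by omega⟩).2]
    · rw [hmout j hj']
      exact hmpos i hi
  obtain ⟨c, hc, hcn, hcov, hlocal⟩ := exists_cover_eq n m
    (fun i => by
      by_cases hi : 0 < i ∧ i + 1 < n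
      · exact (hmpos i hi).le
      · exact (hmout i hi).ge)
    (fun i hi => by
      by_contra h
      exact hi (hmout i h))
  have hcβ : ∀ p ∈ β, c p ≠ 0 := fun p hp => hlocal p (hβ hp) fun i h₁ h₂ =>
    ⟨hmstep p hp i _ h₁ h₂ (Or.inl rfl), hmstep p hp i _ h₁ h₂ (Or.inr rfl)⟩
  set s : ℕ × ℕ → ℝ := fun p => if p ∈ β then t else 0 with hs
  refine ⟨c - s, ⟨fun p hp hpβ => by simpa [hs, hpβ] using hc p, hcn.mono ?_⟩, ?_⟩
  · rintro p ⟨hp, hp'⟩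
    refine ⟨hp, ?_⟩
    by_cases hpβ : p ∈ β
    · exact hcβ p hpβ
    · simpa [hs, hpβ] using hp'
  · ext i
    rw [sum_smul_chordVec_apply, cover_sub, hcov, hmin _ ⟨by omega, by omega⟩]
    have : cover (chords n) s (i + 1) = t * k (i + 1) := by
      simp only [cover, hs, hk, ← Finset.sum_filter, Finset.sum_const, nsmul_eq_mul]
      rw [mul_comm]
      congr 3
      ext p
      have := @hβ p
      simp only [Finset.mem_filter]
      tauto
    rw [this]
    simp

theorem linearIndependent_chordVec (hβ : β ⊆ chords n)
    (hnc : Noncrossing (β : Set (ℕ × ℕ))) :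
    LinearIndependent ℝ fun b : β => chordVec n b := by
  classical
  rw [Fintype.linearIndependent_iff]
  intro g hg b
  set c : ℕ × ℕ → ℝ := fun p => if h : p ∈ β then g ⟨p, h⟩ else 0 with hc
  have hcw : IsLinkWeight n β c := by
    refine ⟨fun p _ hp => by simp [hc, hp], hnc.mono fun p hp => ?_⟩
    by_contra hpβ
    exact hp.2.elim (fun h => h (dif_neg hpβ)) hpβ
  have h0w : IsLinkWeight n β 0 :=
    ⟨fun _ _ _ => le_rfl, hnc.mono fun p hp => hp.2.resolve_left fun h => h rfl⟩
  have hsum : ∑ p ∈ chords n, c p • chordVec n p = 0 := by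
    rw [← Finset.sum_subset hβ fun p _ hp => by simp [hc, hp], ← hg, ← Finset.sum_coe_sort]
    exact Finset.sum_congr rfl fun b _ => by simp [hc]
  have := hcw.eq_of_sum_eq h0w (by simpa using hsum) b (hβ b.2)
  simpa [hc] using this

end LinkWeight

section Link

variable {n : ℕ} {α : Finset (ℕ × ℕ)}

lemma mem_diag_iff {p : ℕ × ℕ} : p ∈ Diag n ↔ p ∈ chords n ∧ p ≠ (0, n - 1) := by
  simp only [Diag, Set.mem_ofPred_eq, mem_chords]
  constructor
  · rintro ⟨h₁, h₂, h₃, h₄⟩; exact ⟨by omega, h₄⟩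
  · rintro ⟨h₁, h₄⟩; exact ⟨by omega, by omega, by omega, h₄⟩

lemma not_crosses_side {p : ℕ × ℕ} (hp : p ∈ chords n) : ¬ Crosses p (0, n - 1) := by
  have := mem_chords.1 hp
  simp only [Crosses]
  omega

lemma noncrossing_insert_side (hα : ↑α ⊆ Diag n) (hnc : Noncrossing (α : Set (ℕ × ℕ))) :
    Noncrossing (insert (0, n - 1) α : Finset (ℕ × ℕ)) := by
  intro p hp q hq
  rw [Finset.mem_coe, Finset.mem_insert] at hp hq
  rcases hp with rfl | hp <;> rcases hq with rfl | hq
  · simp [Crosses]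
  · exact fun h => not_crosses_side (mem_diag_iff.1 (hα hq)).1 h.symm
  · exact not_crosses_side (mem_diag_iff.1 (hα hp)).1
  · exact hnc p hp q hq

/-- The finite set of diagonals underlying `LinkDiag n α`. -/
noncomputable def linkFinset (n : ℕ) (α : Finset (ℕ × ℕ)) : Finset (ℕ × ℕ) :=
  open Classical in
  (chords n).filter fun d => d ≠ (0, n - 1) ∧ d ∉ α ∧ ∀ a ∈ α, ¬ Crosses d a

lemma mem_linkFinset {d : ℕ × ℕ} :
    d ∈ linkFinset n α ↔ d ∈ Diag n ∧ d ∉ α ∧ ∀ a ∈ α, ¬ Crosses d a := by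
  simp [linkFinset, mem_diag_iff, and_assoc]

noncomputable instance (n : ℕ) (α : Finset (ℕ × ℕ)) : Fintype (LinkDiag n α) :=
  Fintype.subtype (linkFinset n α) fun _ => mem_linkFinset

lemma sum_linkFinset {M : Type*} [AddCommMonoid M] (f : ℕ × ℕ → M) :
    ∑ p ∈ linkFinset n α, f p = ∑ d : LinkDiag n α, f d.1 :=
  Finset.sum_subtype _ (fun _ => mem_linkFinset) f

/-- The linear map sending a weighting of the link to the weighted sum of its chord vectors. -/
noncomputable def linkMap (n : ℕ) (α : Finset (ℕ × ℕ)) :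
    (LinkDiag n α → ℝ) →ₗ[ℝ] (Fin (n - 2) → ℝ) :=
  Fintype.linearCombination ℝ fun d => chordVec n d.1

lemma linkMap_apply (w : LinkDiag n α → ℝ) : linkMap n α w = ∑ d, w d • chordVec n d.1 := rfl

lemma sum_chords_eq {c : ℕ × ℕ → ℝ} (hβ : insert (0, n - 1) α ⊆ chords n)
    (hc : IsLinkWeight n (insert (0, n - 1) α) c) :
    ∑ p ∈ chords n, c p • chordVec n p =
      ∑ p ∈ insert (0, n - 1) α, c p • chordVec n p + linkMap n α fun d => c d.1 := by
  have hdisj : Disjoint (insert (0, n - 1) α) (linkFinset n α) := by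
    rw [Finset.disjoint_left]
    intro p hp hpl
    rw [mem_linkFinset, mem_diag_iff] at hpl
    rw [Finset.mem_insert] at hp
    tauto
  rw [linkMap_apply, ← sum_linkFinset fun p => c p • chordVec n p, ← Finset.sum_union hdisj]
  refine (Finset.sum_subset (Finset.union_subset hβ fun p hp =>
    (mem_diag_iff.1 (mem_linkFinset.1 hp).1).1) fun p hp hpn => ?_).symm
  simp only [Finset.mem_union, mem_linkFinset, mem_diag_iff, Finset.mem_insert] at hpn
  by_contra hne
  have hcp : c p ≠ 0 := fun h => hne (by simp [h])
  have : ∀ a ∈ α, ¬ Crosses p a := fun a ha => hc.2 p ⟨hp, Or.inl hcp⟩ a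
    ⟨hβ (Finset.mem_insert_of_mem ha), Or.inr (Finset.mem_insert_of_mem ha)⟩
  tauto

/-- The span of the chord vectors of `α` and of the side `(0, n - 1)`. -/
def linkSpan (n : ℕ) (α : Finset (ℕ × ℕ)) : Submodule ℝ (Fin (n - 2) → ℝ) :=
  Submodule.span ℝ (Set.range fun b : (insert (0, n - 1) α : Finset (ℕ × ℕ)) => chordVec n b)

lemma sum_mem_linkSpan (c : ℕ × ℕ → ℝ) :
    ∑ p ∈ insert (0, n - 1) α, c p • chordVec n p ∈ linkSpan n α :=
  Submodule.sum_mem _ fun p hp => Submodule.smul_mem _ _ (Submodule.subset_span ⟨⟨p, hp⟩, rfl⟩)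

lemma mem_linkSpan {x : Fin (n - 2) → ℝ} (hx : x ∈ linkSpan n α) :
    ∃ g : ℕ × ℕ → ℝ, ∑ p ∈ insert (0, n - 1) α, g p • chordVec n p = x := by
  obtain ⟨g, rfl⟩ := (Submodule.mem_span_range_iff_exists_fun ℝ).1 hx
  refine ⟨fun p => if h : p ∈ insert (0, n - 1) α then g ⟨p, h⟩ else 0, ?_⟩
  rw [← Finset.sum_coe_sort]
  exact Finset.sum_congr rfl fun b _ => by simp only [b.2, dif_pos, Subtype.coe_eta]

/-- Modulo the span of `α` and the side `(0, n - 1)`, every vector is represented by a nonnegative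
weighting of the link with noncrossing support. -/
theorem exists_linkMap_eq (hn : 2 ≤ n) (hβ : insert (0, n - 1) α ⊆ chords n)
    (hnc : Noncrossing (insert (0, n - 1) α : Finset (ℕ × ℕ)))
    (q : (Fin (n - 2) → ℝ) ⧸ linkSpan n α) :
    ∃ w : LinkDiag n α → ℝ, 0 ≤ w ∧ Noncrossing (Subtype.val '' Function.support w) ∧
      (linkSpan n α).mkQ (linkMap n α w) = q := by
  obtain ⟨x, rfl⟩ := (linkSpan n α).mkQ_surjective q
  obtain ⟨c, hc, rfl⟩ := exists_isLinkWeight hn hβ hnc (Finset.mem_insert_self _ _) x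
  have hchord : ∀ d : LinkDiag n α, d.1 ∈ chords n := fun d => (mem_diag_iff.1 d.2.1).1
  refine ⟨fun d => c d.1, fun d => hc.1 d.1 (hchord d) fun hd => ?_, hc.2.mono ?_, ?_⟩
  · rcases Finset.mem_insert.1 hd with h | h
    · exact (mem_diag_iff.1 d.2.1).2 h
    · exact d.2.2.1 h
  · rintro _ ⟨d, hd, rfl⟩
    exact ⟨hchord d, Or.inl hd⟩
  · have h0 : (linkSpan n α).mkQ (∑ p ∈ insert (0, n - 1) α, c p • chordVec n p) = 0 := by
      rw [← LinearMap.mem_ker, Submodule.ker_mkQ]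
      exact sum_mem_linkSpan c
    rw [sum_chords_eq hβ hc, map_add, h0, zero_add]

/-- A nonnegative weighting of the link with noncrossing support is determined by the vector it
represents modulo the span of `α` and the side `(0, n - 1)`. -/
theorem eq_of_linkMap_eq (hβ : insert (0, n - 1) α ⊆ chords n)
    (hnc : Noncrossing (insert (0, n - 1) α : Finset (ℕ × ℕ))) {w w' : LinkDiag n α → ℝ}
    (hw : 0 ≤ w) (hw' : 0 ≤ w')
    (hwn : Noncrossing (Subtype.val '' Function.support w))
    (hwn' : Noncrossing (Subtype.val '' Function.support w'))
    (h : (linkSpan n α).mkQ (linkMap n α w) = (linkSpan n α).mkQ (linkMap n α w')) : w = w' := by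
  classical
  rw [← sub_eq_zero, ← map_sub, ← LinearMap.mem_ker, Submodule.ker_mkQ] at h
  obtain ⟨g, hg⟩ := mem_linkSpan h
  let extend (w : LinkDiag n α → ℝ) (g : ℕ × ℕ → ℝ) (p : ℕ × ℕ) : ℝ :=
    if h : p ∈ Diag n ∧ p ∉ α ∧ ∀ a ∈ α, ¬ Crosses p a then w ⟨p, h⟩
      else if p ∈ insert (0, n - 1) α then g p else 0
  have hext : ∀ w g (d : LinkDiag n α), extend w g d.1 = w d := fun w g d => dif_pos d.2
  have hextβ : ∀ w g, ∀ p ∈ insert (0, n - 1) α, extend w g p = g p := by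
    intro w g p hp
    have : ¬ (p ∈ Diag n ∧ p ∉ α ∧ ∀ a ∈ α, ¬ Crosses p a) := by
      rw [mem_diag_iff]
      rw [Finset.mem_insert] at hp
      tauto
    simp only [extend, dif_neg this, if_pos hp]
  have hsupp : ∀ w g p, extend w g p ≠ 0 ∨ p ∈ insert (0, n - 1) α →
      (∃ d : LinkDiag n α, w d ≠ 0 ∧ d.1 = p) ∨ p ∈ insert (0, n - 1) α := by
    rintro w g p (hp | hp)
    · by_cases h : p ∈ Diag n ∧ p ∉ α ∧ ∀ a ∈ α, ¬ Crosses p a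
      · exact Or.inl ⟨⟨p, h⟩, by simpa only [extend, dif_pos h] using hp, rfl⟩
      · right
        by_contra hpβ
        exact hp (by simp only [extend, dif_neg h, if_neg hpβ])
    · exact Or.inr hp
  have hlink : ∀ (d : LinkDiag n α), ∀ p ∈ insert (0, n - 1) α, ¬ Crosses d.1 p := by
    intro d p hp
    rcases Finset.mem_insert.1 hp with rfl | hp
    · exact not_crosses_side (mem_diag_iff.1 d.2.1).1
    · exact d.2.2.2 p hp
  have hweight : ∀ w g, 0 ≤ w → Noncrossing (Subtype.val '' Function.support w) →
      IsLinkWeight n (insert (0, n - 1) α) (extend w g) := by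
    intro w g hw hwn
    refine ⟨fun p _ hpβ => ?_, ?_⟩
    · simp only [extend, if_neg hpβ]
      split_ifs
      · exact hw _
      · exact le_rfl
    · rintro p ⟨-, hp⟩ q ⟨-, hq⟩
      rcases hsupp w g p hp with ⟨d, hd, rfl⟩ | hp <;>
        rcases hsupp w g q hq with ⟨d', hd', rfl⟩ | hq
      · exact hwn _ ⟨d, hd, rfl⟩ _ ⟨d', hd', rfl⟩
      · exact hlink d q hq
      · exact fun h => hlink d' p hp h.symm
      · exact hnc p hp q hq
  have hW := hweight w 0 hw hwn
  have hW' := hweight w' g hw' hwn'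
  have hsum : ∑ p ∈ insert (0, n - 1) α, extend w 0 p • chordVec n p = 0 :=
    Finset.sum_eq_zero fun p hp => by simp [hextβ w 0 p hp]
  have hsum' : ∑ p ∈ insert (0, n - 1) α, extend w' g p • chordVec n p =
      linkMap n α w - linkMap n α w' := by
    rw [← hg]
    exact Finset.sum_congr rfl fun p hp => by rw [hextβ w' g p hp]
  have heq := hW.eq_of_sum_eq hW' (by
    rw [sum_chords_eq hβ hW, sum_chords_eq hβ hW', hsum, hsum']
    simp [hext])
  ext d
  rw [← hext w 0 d, heq d.1 (mem_diag_iff.1 d.2.1).1, hext]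

lemma finrank_quotient_linkSpan (hα : ↑α ⊆ Diag n) (hβ : insert (0, n - 1) α ⊆ chords n)
    (hnc : Noncrossing (insert (0, n - 1) α : Finset (ℕ × ℕ))) :
    Module.finrank ℝ ((Fin (n - 2) → ℝ) ⧸ linkSpan n α) = n - 3 - α.card := by
  have hside : (0, n - 1) ∉ α := fun h => (mem_diag_iff.1 (hα h)).2 rfl
  have hspan := finrank_span_eq_card (linearIndependent_chordVec hβ hnc)
  rw [Fintype.card_coe, Finset.card_insert_of_notMem hside] at hspan
  rw [Submodule.finrank_quotient, linkSpan, hspan, Module.finrank_fin_fun]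
  omega

end Link

/-- Polygons are inductive: for a noncrossing family `α` of `k` diagonals of the
`n`-gon, the link of the corresponding simplex in the arc complex — the simplicial
complex on the diagonals disjoint from and not crossing `α`, with simplices the
nonempty noncrossing sets of such diagonals — has underlying space homeomorphic
to the sphere of dimension `n - 4 - k`. -/
theorem arcComplex_polygon_link_spherical (n k : ℕ) (hn : 5 ≤ n)
    (α : Finset (ℕ × ℕ)) (hα : ↑α ⊆ Diag n) (hnc : Noncrossing ↑α)
    (hcard : α.card = k) (hk1 : 1 ≤ k) (hk2 : k ≤ n - 4) :
    ∃ (N : ℕ) (L : Geometry.SimplicialComplex ℝ (Fin N → ℝ))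
      (e : LinkDiag n α ≃ L.vertices),
      (∀ S : Finset (LinkDiag n α), S.Nonempty →
        (Noncrossing (Subtype.val '' (S : Set (LinkDiag n α))) ↔
          S.image (fun d => ((e d : L.vertices) : Fin N → ℝ)) ∈ L.faces)) ∧
      Nonempty (L.space ≃ₜ Metric.sphere (0 : EuclideanSpace ℝ (Fin (n - 3 - k))) 1) := by
  classical
  have hβ : insert (0, n - 1) α ⊆ chords n := by
    refine Finset.insert_subset (mem_chords.2 ⟨by simp; omega, by simp; omega⟩) fun p hp => ?_
    exact (mem_diag_iff.1 (hα hp)).1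
  have hncβ := noncrossing_insert_side hα hnc
  let ψ : ((Fin (n - 2) → ℝ) ⧸ linkSpan n α) ≃ₗ[ℝ] EuclideanSpace ℝ (Fin (n - 3 - k)) :=
    LinearEquiv.ofFinrankEq _ _ (by
      rw [finrank_quotient_linkSpan hα hβ hncβ, finrank_euclideanSpace_fin, hcard])
  let σ := Fintype.equivFin (LinkDiag n α)
  let P : Set (Fin (Fintype.card (LinkDiag n α))) → Prop := fun S =>
    Noncrossing (Subtype.val '' (σ ⁻¹' S))
  have hP : ∀ S S', P S → S' ⊆ S → P S' := fun S S' h hS =>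
    h.mono (Set.image_mono (Set.preimage_mono hS))
  let φ : (Fin (Fintype.card (LinkDiag n α)) → ℝ) →ₗ[ℝ] EuclideanSpace ℝ (Fin (n - 3 - k)) :=
    ψ.toLinearMap ∘ₗ (linkSpan n α).mkQ ∘ₗ linkMap n α ∘ₗ LinearMap.funLeft ℝ ℝ σ
  have hφ : ∀ c, φ c = ψ ((linkSpan n α).mkQ (linkMap n α (c ∘ σ))) := fun c => rfl
  have hinj : Function.Injective fun i =>
      (Pi.single i 1 : Fin (Fintype.card (LinkDiag n α)) → ℝ) := fun i j h => by
    by_contra hij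
    simpa [hij] using congrFun h i
  have hface : ∀ S : Finset (Fin (Fintype.card (LinkDiag n α))), S.Nonempty →
      (P S ↔ S.image (fun i => Pi.single i 1) ∈ (stdRealization P hP).faces) := by
    intro S hS
    rw [mem_stdRealization_faces]
    refine ⟨fun h => ⟨S, hS, h, Finset.coe_image⟩, ?_⟩
    rintro ⟨S', -, hS', h⟩
    rw [Finset.coe_image] at h
    rwa [hinj.image_injective h]
  have hvert : ∀ x, x ∈ (stdRealization P hP).vertices ↔ ∃ i, Pi.single i 1 = x := by
    intro x
    rw [Geometry.SimplicialComplex.mem_vertices]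
    constructor
    · intro hx
      obtain ⟨S, ⟨i, hi⟩, -, h⟩ := mem_stdRealization_faces.1 hx
      refine ⟨i, ?_⟩
      have : (Pi.single i 1 : Fin (Fintype.card (LinkDiag n α)) → ℝ) ∈
        (({x} : Finset _) : Set (Fin (Fintype.card (LinkDiag n α)) → ℝ)) := h ▸ ⟨i, hi, rfl⟩
      simpa using this
    · rintro ⟨i, rfl⟩
      have hPi : P (({i} : Finset _) : Set _) := by
        rintro _ ⟨d, hd, rfl⟩ _ ⟨d', hd', rfl⟩
        have hdi : σ d = i := Finset.mem_singleton.1 (Finset.mem_coe.1 hd)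
        have hdi' : σ d' = i := Finset.mem_singleton.1 (Finset.mem_coe.1 hd')
        obtain rfl := σ.injective (hdi.trans hdi'.symm)
        simp [Crosses]
      simpa using (hface {i} (Finset.singleton_nonempty i)).1 hPi
  let e : LinkDiag n α ≃ (stdRealization P hP).vertices :=
    σ.trans (Equiv.ofBijective (fun i => ⟨Pi.single i 1, (hvert _).2 ⟨i, rfl⟩⟩)
      ⟨fun i j h => hinj (congrArg Subtype.val h), fun x =>
        let ⟨i, hi⟩ := (hvert x.1).1 x.2
        ⟨i, Subtype.ext hi⟩⟩)
  refine ⟨_, stdRealization P hP, e, fun S hS => ?_,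
    nonempty_stdRealization_space_homeomorph_sphere φ (fun x => ?_)
      fun c c' hc hc' hPc hPc' h => ?_⟩
  · have h := hface (S.image σ) (hS.image _)
    rw [Finset.image_image] at h
    have hS' : σ ⁻¹' ((S.image σ : Finset _) : Set _) = (S : Set (LinkDiag n α)) := by
      rw [Finset.coe_image, Set.preimage_image_eq _ σ.injective]
    have hPS : P ((S.image σ : Finset _) : Set _) ↔
        Noncrossing (Subtype.val '' (S : Set (LinkDiag n α))) :=
      Iff.of_eq (congrArg (fun s => Noncrossing (Subtype.val '' s)) hS')
    refine hPS.symm.trans (h.trans (Iff.of_eq ?_))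
    congr!
  · obtain ⟨w, hw, hwn, h⟩ := exists_linkMap_eq (by omega) hβ hncβ (ψ.symm x)
    have hwσ : (w ∘ σ.symm) ∘ σ = w := by ext; simp
    refine ⟨w ∘ σ.symm, fun i => hw _, ?_, by rw [hφ, hwσ, h, ψ.apply_symm_apply]⟩
    exact (congrArg (fun v : LinkDiag n α → ℝ =>
      Noncrossing (Subtype.val '' Function.support v)) hwσ).mpr hwn
  · simp only [hφ, ψ.injective.eq_iff] at h
    have := eq_of_linkMap_eq hβ hncβ (fun d => hc (σ d)) (fun d => hc' (σ d)) hPc hPc' h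
    exact σ.surjective.injective_comp_right this
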